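/- arXiv:1111.4388 — 9 statements merged into one kernel-verified Lean document; each statement's English description precedes it below -/
import Mathlib

section
/- For every real number α with 1 < α < 2 and every real λ ≥ 0, the integral ∫₀^∞ (e^{−λx} − 1 + λx) · (α(α−1)/Γ(2−α)) · x^{−1−α} dx converges and equals λ^α, where Γ denotes the real Gamma function. -/
open Real MeasureTheory Set

section MellinByParts

open Filter Topology Asymptotics

/-- Integration by parts for the Mellin integral of a real function: the decay of `f` at `0` and
at infinity makes the boundary terms vanish. -/
theorem integral_rpow_sub_one_mul_eq_of_hasDerivAt {f f' : ℝ → ℝ} {a b s : ℝ}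
    (hf : ∀ x ∈ Ioi (0 : ℝ), HasDerivAt f (f' x) x)
    (htop : f =O[atTop] (fun x => x ^ (-a))) (hs : s < a)
    (hzero : f =O[𝓝[>] 0] (fun x => x ^ (-b))) (hb : b < s)
    (hint : IntegrableOn (fun x => x ^ s * f' x) (Ioi 0)) :
    IntegrableOn (fun x => x ^ (s - 1) * f x) (Ioi 0) ∧
      s * ∫ x in Ioi (0 : ℝ), x ^ (s - 1) * f x = -∫ x in Ioi (0 : ℝ), x ^ s * f' x := by
  have hcont : ContinuousOn f (Ioi 0) := fun x hx => (hf x hx).continuousAt.continuousWithinAt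
  have hconv : IntegrableOn (fun x => x ^ (s - 1) * f x) (Ioi 0) :=
    mellin_convergent_of_isBigO_scalar (hcont.locallyIntegrableOn measurableSet_Ioi)
      htop hs hzero hb
  refine ⟨hconv, ?_⟩
  have h0 : Tendsto (fun x => x ^ s * f x) (𝓝[>] 0) (𝓝 0) := by
    refine ((isBigO_refl (fun x : ℝ => x ^ s) (𝓝[>] 0)).mul hzero).trans_tendsto ?_
    have : Tendsto (fun x : ℝ => x ^ (s - b)) (𝓝[>] 0) (𝓝 0) := by
      have := (continuousAt_rpow_const 0 (s - b) (Or.inr (by linarith))).tendsto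
      rw [zero_rpow (by linarith)] at this
      exact this.mono_left nhdsWithin_le_nhds
    refine this.congr' ?_
    filter_upwards [self_mem_nhdsWithin] with x hx
    rw [← rpow_add hx, sub_eq_add_neg]
  have h1 : Tendsto (fun x => x ^ s * f x) atTop (𝓝 0) := by
    refine ((isBigO_refl (fun x : ℝ => x ^ s) atTop).mul htop).trans_tendsto ?_
    refine (tendsto_rpow_neg_atTop (sub_pos.2 hs)).congr' ?_
    filter_upwards [eventually_gt_atTop 0] with x hx
    rw [← rpow_add hx]
    ring_nf
  have key := integral_Ioi_mul_deriv_eq_deriv_mul (u := fun x => x ^ s) (v := f)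
    (u' := fun x => s * x ^ (s - 1)) (v' := f') (a := 0) (a' := 0) (b' := 0)
    (fun x hx => hasDerivAt_rpow_const (Or.inl (ne_of_gt hx))) hf hint
    (by simpa [Pi.mul_def, mul_assoc, IntegrableOn] using hconv.const_mul s) h0 h1
  simp only [mul_assoc, integral_const_mul] at key
  linarith

end MellinByParts

section ExpRemainder

theorem one_sub_exp_neg_nonneg {u : ℝ} (hu : 0 ≤ u) : 0 ≤ 1 - exp (-u) :=
  sub_nonneg.2 (exp_le_one_iff.2 (by linarith))

theorem one_sub_exp_neg_le_self (u : ℝ) : 1 - exp (-u) ≤ u := by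
  linarith [add_one_le_exp (-u)]

theorem exp_neg_sub_one_add_self_le_sq {u : ℝ} (hu : 0 ≤ u) : exp (-u) - 1 + u ≤ u ^ 2 := by
  have h1 : exp (-u) * (u + 1) ≤ 1 := by
    calc exp (-u) * (u + 1) ≤ exp (-u) * exp u := by gcongr; exact add_one_le_exp u
      _ = 1 := by rw [← exp_add]; simp
  nlinarith [mul_le_mul_of_nonneg_left (one_sub_exp_neg_le_self u) hu]

end ExpRemainder

section StableExponent

open Filter Topology Asymptotics

theorem integral_rpow_neg_mul_one_sub_exp {α r : ℝ} (hα₁ : 1 < α) (hα₂ : α < 2) (hr : 0 < r) :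
    IntegrableOn (fun x => x ^ (-α) * (1 - exp (-(r * x)))) (Ioi 0) ∧
      (α - 1) * ∫ x in Ioi (0 : ℝ), x ^ (-α) * (1 - exp (-(r * x))) =
        r ^ (α - 1) * Gamma (2 - α) := by
  have hderiv : ∀ x ∈ Ioi (0 : ℝ),
      HasDerivAt (fun x => 1 - exp (-(r * x))) (r * exp (-(r * x))) x := fun x _ => by
    have h : HasDerivAt (fun x => r * x) r x := hasDerivAt_const_mul r
    exact (h.fun_neg.exp.const_sub 1).congr_deriv (by ring)
  have hint : IntegrableOn (fun x => x ^ (1 - α) * (r * exp (-(r * x)))) (Ioi 0) := by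
    have := (integrableOn_rpow_mul_exp_neg_mul_rpow (s := 1 - α) (p := 1) (b := r)
      (by linarith) one_pos hr).const_mul r
    refine IntegrableOn.congr_fun this (fun x _ => ?_) measurableSet_Ioi
    simp only [rpow_one, neg_mul]
    ring
  have htop : (fun x => 1 - exp (-(r * x))) =O[atTop] (fun x : ℝ => x ^ (-(0 : ℝ))) := by
    refine IsBigO.of_bound 1 ?_
    filter_upwards [eventually_gt_atTop 0] with x hx
    rw [norm_of_nonneg (one_sub_exp_neg_nonneg (by positivity))]
    simp [exp_nonneg]
  have hzero : (fun x => 1 - exp (-(r * x))) =O[𝓝[>] 0] (fun x : ℝ => x ^ (-(-1 : ℝ))) := by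
    refine IsBigO.of_bound r ?_
    filter_upwards [self_mem_nhdsWithin] with x (hx : 0 < x)
    rw [norm_of_nonneg (one_sub_exp_neg_nonneg (by positivity)), neg_neg, rpow_one,
      norm_of_nonneg hx.le]
    exact one_sub_exp_neg_le_self _
  obtain ⟨h1, h2⟩ := integral_rpow_sub_one_mul_eq_of_hasDerivAt hderiv htop (by linarith)
    hzero (by linarith) hint
  have hs : 1 - α - 1 = -α := by ring
  rw [hs] at h1 h2
  refine ⟨h1, ?_⟩
  have hG := integral_rpow_mul_exp_neg_mul_Ioi (a := 2 - α) (by linarith) hr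
  rw [show 2 - α - 1 = 1 - α by ring] at hG
  simp only [mul_left_comm _ r, integral_const_mul] at h2
  rw [hG] at h2
  have hpow : r * (1 / r) ^ (2 - α) = r ^ (α - 1) := by
    rw [one_div, inv_rpow hr.le, ← rpow_neg hr.le, ← rpow_one_add' hr.le (by linarith)]
    ring_nf
  rw [← hpow]
  linarith

theorem integral_rpow_mul_exp_neg_sub_one_add {α r : ℝ} (hα₁ : 1 < α) (hα₂ : α < 2) (hr : 0 < r) :
    IntegrableOn (fun x => x ^ (-1 - α) * (exp (-(r * x)) - 1 + r * x)) (Ioi 0) ∧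
      α * (α - 1) * ∫ x in Ioi (0 : ℝ), x ^ (-1 - α) * (exp (-(r * x)) - 1 + r * x) =
        r ^ α * Gamma (2 - α) := by
  obtain ⟨hI, hV⟩ := integral_rpow_neg_mul_one_sub_exp hα₁ hα₂ hr
  have hnonneg (x : ℝ) : 0 ≤ exp (-(r * x)) - 1 + r * x := by
    linarith [one_sub_exp_neg_le_self (r * x)]
  have hderiv : ∀ x ∈ Ioi (0 : ℝ),
      HasDerivAt (fun x => exp (-(r * x)) - 1 + r * x) (r * (1 - exp (-(r * x)))) x := fun x _ => by
    have h : HasDerivAt (fun x => r * x) r x := hasDerivAt_const_mul r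
    exact ((h.fun_neg.exp.sub_const 1).fun_add h).congr_deriv (by ring)
  have hint : IntegrableOn (fun x => x ^ (-α) * (r * (1 - exp (-(r * x))))) (Ioi 0) := by
    simpa only [mul_left_comm _ r, IntegrableOn] using hI.const_mul r
  have htop : (fun x => exp (-(r * x)) - 1 + r * x) =O[atTop]
      (fun x : ℝ => x ^ (-(-1 : ℝ))) := by
    refine IsBigO.of_bound r ?_
    filter_upwards [eventually_gt_atTop 0] with x hx
    rw [norm_of_nonneg (hnonneg x), neg_neg, rpow_one, norm_of_nonneg hx.le]
    linarith [one_sub_exp_neg_nonneg (u := r * x) (by positivity)]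
  have hzero : (fun x => exp (-(r * x)) - 1 + r * x) =O[𝓝[>] 0]
      (fun x : ℝ => x ^ (-(-2 : ℝ))) := by
    refine IsBigO.of_bound (r ^ 2) ?_
    filter_upwards [self_mem_nhdsWithin] with x (hx : 0 < x)
    rw [norm_of_nonneg (hnonneg x), neg_neg, rpow_two, norm_of_nonneg (by positivity), ← mul_pow]
    exact exp_neg_sub_one_add_self_le_sq (by positivity)
  obtain ⟨h1, h2⟩ := integral_rpow_sub_one_mul_eq_of_hasDerivAt hderiv htop (by linarith)
    hzero (by linarith) hint
  rw [show -α - 1 = -1 - α by ring] at h1 h2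
  refine ⟨h1, ?_⟩
  simp only [mul_left_comm _ r, integral_const_mul] at h2
  have hpow : r ^ α = r * r ^ (α - 1) := by
    rw [← rpow_one_add' hr.le (by linarith)]
    ring_nf
  rw [hpow, mul_assoc r, ← hV]
  linear_combination (1 - α) * h2

end StableExponent

theorem stmt_0 (α lam : ℝ) (hα₁ : 1 < α) (hα₂ : α < 2) (hlam : 0 ≤ lam) :
    IntegrableOn
      (fun x : ℝ => (Real.exp (-lam * x) - 1 + lam * x) *
        (α * (α - 1) / Real.Gamma (2 - α)) * x ^ (-1 - α)) (Ioi 0) volume ∧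
    ∫ x in Ioi (0 : ℝ),
        (Real.exp (-lam * x) - 1 + lam * x) *
          (α * (α - 1) / Real.Gamma (2 - α)) * x ^ (-1 - α)
      = lam ^ α := by
  rcases hlam.eq_or_lt with rfl | hpos
  · simp [zero_rpow (by linarith : α ≠ 0)]
  obtain ⟨hI, hV⟩ := integral_rpow_mul_exp_neg_sub_one_add hα₁ hα₂ hpos
  have hΓ : Gamma (2 - α) ≠ 0 := (Gamma_pos_of_pos (by linarith)).ne'
  have heq : (fun x : ℝ => (exp (-lam * x) - 1 + lam * x) *
      (α * (α - 1) / Gamma (2 - α)) * x ^ (-1 - α)) =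
      fun x => α * (α - 1) / Gamma (2 - α) *
        (x ^ (-1 - α) * (exp (-(lam * x)) - 1 + lam * x)) := by
    funext x
    rw [neg_mul]
    ring
  rw [heq]
  refine ⟨hI.const_mul _, ?_⟩
  rw [integral_const_mul, div_mul_eq_mul_div, hV, mul_div_cancel_right₀ _ hΓ]
end

section
/- Let p, q, m, n be positive real numbers with p − m > 0 and q − n < 0. Then Γ(p+n) · Γ(q+m) > Γ(p+q) · Γ(m+n), where Γ denotes the real Gamma function. -/
/-- Log-convexity of `Γ`, in the form of a comparison of products with equal argument sums. -/
lemma Real.Gamma_add_mul_Gamma_add_le {x s t : ℝ} (hx : 0 < x) (hs : 0 < s) (ht : 0 < t) :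
    Real.Gamma (x + s) * Real.Gamma (x + t) ≤ Real.Gamma x * Real.Gamma (x + s + t) := by
  have hst : 0 < s + t := by positivity
  have hy : 0 < x + s + t := by positivity
  have hsum : t / (s + t) + s / (s + t) = 1 := by field_simp; ring
  have h₁ := Real.Gamma_mul_add_mul_le_rpow_Gamma_mul_rpow_Gamma hx hy
    (div_pos ht hst) (div_pos hs hst) hsum
  have h₂ := Real.Gamma_mul_add_mul_le_rpow_Gamma_mul_rpow_Gamma hx hy
    (div_pos hs hst) (div_pos ht hst) (by rw [add_comm, hsum])
  rw [show t / (s + t) * x + s / (s + t) * (x + s + t) = x + s by field_simp; ring] at h₁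
  rw [show s / (s + t) * x + t / (s + t) * (x + s + t) = x + t by field_simp; ring] at h₂
  have hGx := Real.Gamma_pos_of_pos hx
  have hGy := Real.Gamma_pos_of_pos hy
  calc Real.Gamma (x + s) * Real.Gamma (x + t)
      ≤ _ := mul_le_mul h₁ h₂ (Real.Gamma_pos_of_pos (by positivity)).le (by positivity)
    _ = Real.Gamma x ^ (t / (s + t) + s / (s + t)) *
          Real.Gamma (x + s + t) ^ (t / (s + t) + s / (s + t)) := by
        rw [Real.rpow_add hGx, Real.rpow_add hGy]; ring
    _ = Real.Gamma x * Real.Gamma (x + s + t) := by simp only [hsum, Real.rpow_one]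

/-- Strictness follows from the non-strict inequality at `x + 1` and `Γ (x + 1) = x * Γ x`. -/
lemma Real.Gamma_add_mul_Gamma_add_lt {x s t : ℝ} (hx : 0 < x) (hs : 0 < s) (ht : 0 < t) :
    Real.Gamma (x + s) * Real.Gamma (x + t) < Real.Gamma x * Real.Gamma (x + s + t) := by
  have hxs : 0 < x + s := by positivity
  have hxt : 0 < x + t := by positivity
  have hy : 0 < x + s + t := by positivity
  have h := Real.Gamma_add_mul_Gamma_add_le (add_pos hx one_pos) hs ht
  rw [show x + 1 + s = x + s + 1 by ring, show x + 1 + t = x + t + 1 by ring,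
    show x + s + 1 + t = x + s + t + 1 by ring, Real.Gamma_add_one hx.ne',
    Real.Gamma_add_one hxs.ne', Real.Gamma_add_one hxt.ne', Real.Gamma_add_one hy.ne'] at h
  have hG : 0 < Real.Gamma x * Real.Gamma (x + s + t) :=
    mul_pos (Real.Gamma_pos_of_pos hx) (Real.Gamma_pos_of_pos hy)
  refine lt_of_mul_lt_mul_left ?_ (mul_pos hxs hxt).le
  calc (x + s) * (x + t) * (Real.Gamma (x + s) * Real.Gamma (x + t))
      ≤ x * (x + s + t) * (Real.Gamma x * Real.Gamma (x + s + t)) := by linarith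
    _ < (x + s) * (x + t) * (Real.Gamma x * Real.Gamma (x + s + t)) :=
        mul_lt_mul_of_pos_right (by linarith [mul_pos hs ht]) hG

theorem stmt_1 (p q m n : ℝ) (hp : 0 < p) (hq : 0 < q) (hm : 0 < m) (hn : 0 < n)
    (hpm : 0 < p - m) (hqn : q - n < 0) :
    Real.Gamma (p + q) * Real.Gamma (m + n) < Real.Gamma (p + n) * Real.Gamma (q + m) := by
  have h := Real.Gamma_add_mul_Gamma_add_lt (add_pos hq hm) hpm
    (show 0 < n - q by linarith)
  rwa [show q + m + (p - m) = p + q by ring, show q + m + (n - q) = m + n by ring,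
    show p + q + (n - q) = p + n by ring, mul_comm (Real.Gamma (q + m))] at h
end

section
/- Let α be a real number with 1 < α < 2, let β ∈ (1−1/α, 1), and set η := 1 − α(1−β), so that η ∈ (0,1). Then Γ(αβ)/Γ(η) < Γ(α), where Γ denotes the real Gamma function. -/
/-- Log-convexity of the Gamma function on four points with equal sums: the inner pair has the
smaller product. -/
theorem Gamma_mul_Gamma_le_of_add_eq_add {x y p q : ℝ} (hx : 0 < x) (hxp : x < p) (hpy : p < y)
    (hsum : p + q = x + y) :
    Real.Gamma p * Real.Gamma q ≤ Real.Gamma x * Real.Gamma y := by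
  have hd : 0 < y - x := by linarith
  have hy : 0 < y := by linarith
  obtain ⟨w, hw⟩ : ∃ w, w = (y - p) / (y - x) := ⟨_, rfl⟩
  have hwd : w * (y - x) = y - p := by rw [hw]; field_simp
  have hw0 : 0 < w := by rw [hw]; exact div_pos (by linarith) hd
  have hw1 : 0 < 1 - w := by
    have : w < 1 := by rw [hw, div_lt_one hd]; linarith
    linarith
  have hp : w * x + (1 - w) * y = p := by linear_combination -hwd
  have hq : (1 - w) * x + w * y = q := by linear_combination hwd - hsum
  have h₁ := Real.Gamma_mul_add_mul_le_rpow_Gamma_mul_rpow_Gamma hx hy hw0 hw1 (by ring)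
  have h₂ := Real.Gamma_mul_add_mul_le_rpow_Gamma_mul_rpow_Gamma hx hy hw1 hw0 (by ring)
  rw [hp] at h₁
  rw [hq] at h₂
  have hGx := Real.Gamma_pos_of_pos hx
  have hGy := Real.Gamma_pos_of_pos hy
  have hq0 : 0 < q := by linarith
  calc Real.Gamma p * Real.Gamma q
      ≤ (Real.Gamma x ^ w * Real.Gamma y ^ (1 - w)) *
          (Real.Gamma x ^ (1 - w) * Real.Gamma y ^ w) :=
        mul_le_mul h₁ h₂ (Real.Gamma_pos_of_pos hq0).le (by positivity)
    _ = Real.Gamma x ^ (w + (1 - w)) * Real.Gamma y ^ (w + (1 - w)) := by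
        rw [Real.rpow_add hGx, Real.rpow_add hGy]; ring
    _ = Real.Gamma x * Real.Gamma y := by simp

/-- Strict form of `Gamma_mul_Gamma_le_of_add_eq_add`, obtained by shifting all arguments by one. -/
theorem Gamma_mul_Gamma_lt_of_add_eq_add {x y p q : ℝ} (hx : 0 < x) (hxp : x < p) (hpy : p < y)
    (hsum : p + q = x + y) :
    Real.Gamma p * Real.Gamma q < Real.Gamma x * Real.Gamma y := by
  have hp : 0 < p := by linarith
  have hq : 0 < q := by linarith
  have hy : 0 < y := by linarith
  have h := Gamma_mul_Gamma_le_of_add_eq_add (x := x + 1) (y := y + 1) (p := p + 1) (q := q + 1)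
    (by linarith) (by linarith) (by linarith) (by linarith)
  rw [Real.Gamma_add_one hx.ne', Real.Gamma_add_one hy.ne', Real.Gamma_add_one hp.ne',
    Real.Gamma_add_one hq.ne'] at h
  have hlt : x * y < p * q := by
    have hq' : q = x + y - p := by linarith
    subst hq'
    nlinarith [mul_pos (sub_pos.2 hxp) (sub_pos.2 hpy)]
  have hG := mul_pos (Real.Gamma_pos_of_pos hx) (Real.Gamma_pos_of_pos hy)
  have hpq : 0 < p * q := mul_pos hp hq
  refine lt_of_mul_lt_mul_left ?_ hpq.le
  calc p * q * (Real.Gamma p * Real.Gamma q)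
      = p * Real.Gamma p * (q * Real.Gamma q) := by ring
    _ ≤ x * Real.Gamma x * (y * Real.Gamma y) := h
    _ = x * y * (Real.Gamma x * Real.Gamma y) := by ring
    _ < p * q * (Real.Gamma x * Real.Gamma y) := mul_lt_mul_of_pos_right hlt hG

theorem stmt_2 (α β η : ℝ) (hα₁ : 1 < α) (hα₂ : α < 2) (hβ₁ : 1 - 1 / α < β) (hβ₂ : β < 1)
    (hη : η = 1 - α * (1 - β)) :
    Real.Gamma (α * β) / Real.Gamma η < Real.Gamma α := by
  have hα : 0 < α := by linarith
  have hη0 : 0 < η := by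
    have h : α * (1 - β) < α * (1 / α) := mul_lt_mul_of_pos_left (by linarith) hα
    rw [mul_one_div_cancel hα.ne'] at h
    linarith
  have hη1 : η < 1 := by nlinarith [mul_pos hα (sub_pos.2 hβ₂)]
  rw [div_lt_iff₀ (Real.Gamma_pos_of_pos hη0)]
  have h := Gamma_mul_Gamma_lt_of_add_eq_add (q := α * β) hη0 hη1 hα₁ (by rw [hη]; ring)
  rwa [Real.Gamma_one, one_mul, mul_comm (Real.Gamma η)] at h
end

section
/- Let p, q, m, n be positive real numbers with p − m > 0 and q − n < 0. Then (∫₀¹ x^{p−1}(1−x)^{q−1} dx) · (∫₀¹ x^{m−1}(1−x)^{n−1} dx) > (∫₀¹ x^{p−1}(1−x)^{n−1} dx) · (∫₀¹ x^{m−1}(1−x)^{q−1} dx); that is, B(p,q)·B(m,n) > B(p,n)·B(m,q) for the Beta function B. -/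
open Real MeasureTheory Set

theorem integrableOn_rpow_mul_one_sub_rpow {a b : ℝ} (ha : 0 < a) (hb : 0 < b) :
    IntegrableOn (fun x : ℝ => x ^ (a - 1) * (1 - x) ^ (b - 1)) (Ioo 0 1) := by
  have h := Complex.betaIntegral_convergent (u := a) (v := b) (by simpa) (by simpa)
  rw [intervalIntegrable_iff_integrableOn_Ioo_of_le zero_le_one] at h
  refine IntegrableOn.congr_fun h.re (fun x hx => ?_) measurableSet_Ioo
  have h1 : (0 : ℝ) ≤ 1 - x := sub_nonneg.2 hx.2.le
  have e1 : (x : ℂ) ^ ((a : ℂ) - 1) = ((x ^ (a - 1) : ℝ) : ℂ) := by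
    rw [Complex.ofReal_cpow hx.1.le]; push_cast; rfl
  have e2 : (1 - (x : ℂ)) ^ ((b : ℂ) - 1) = (((1 - x) ^ (b - 1) : ℝ) : ℂ) := by
    rw [Complex.ofReal_cpow h1]; push_cast; rfl
  simp only [e1, e2, ← Complex.ofReal_mul]
  exact Complex.ofReal_re _

theorem setIntegral_Ioo_pos_of_pos_of_ne {f : ℝ → ℝ} {a b : ℝ} (hab : a < b) (c : ℝ)
    (hf : IntegrableOn f (Ioo a b)) (hpos : ∀ x ∈ Ioo a b, x ≠ c → 0 < f x) :
    0 < ∫ x in Ioo a b, f x := by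
  have hae : ∀ᵐ x ∂volume.restrict (Ioo a b), 0 < f x := by
    rw [ae_restrict_iff' measurableSet_Ioo]
    filter_upwards [Measure.ae_ne volume c] with x hx hxI using hpos x hxI hx
  rw [integral_pos_iff_support_of_nonneg_ae (hae.mono fun _ h => h.le) hf]
  have hsupp : Function.support f =ᵐ[volume.restrict (Ioo a b)] univ :=
    Filter.eventuallyEq_univ.2 (hae.mono fun _ h => h.ne')
  rw [measure_congr hsupp]
  simpa using hab

theorem rpow_sub_mul_one_sub_rpow_sub_pos {s t x y : ℝ} (hs : 0 < s) (ht : t < 0)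
    (hx : x ∈ Ioo (0 : ℝ) 1) (hy : y ∈ Ioo (0 : ℝ) 1) (hxy : x ≠ y) :
    0 < (x ^ s - y ^ s) * ((1 - x) ^ t - (1 - y) ^ t) := by
  rcases hxy.lt_or_gt with h | h
  · exact mul_pos_of_neg_of_neg (sub_neg.2 (rpow_lt_rpow hx.1.le h hs))
      (sub_neg.2 (rpow_lt_rpow_of_neg (sub_pos.2 hy.2) (by linarith) ht))
  · exact mul_pos (sub_pos.2 (rpow_lt_rpow hy.1.le h hs))
      (sub_pos.2 (rpow_lt_rpow_of_neg (sub_pos.2 hx.2) (by linarith) ht))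

theorem stmt_3 (p q m n : ℝ) (hp : 0 < p) (hq : 0 < q) (hm : 0 < m) (hn : 0 < n)
    (hpm : 0 < p - m) (hqn : q - n < 0) :
    (∫ x in Ioo (0 : ℝ) 1, x ^ (p - 1) * (1 - x) ^ (n - 1)) *
        (∫ x in Ioo (0 : ℝ) 1, x ^ (m - 1) * (1 - x) ^ (q - 1))
      < (∫ x in Ioo (0 : ℝ) 1, x ^ (p - 1) * (1 - x) ^ (q - 1)) *
        (∫ x in Ioo (0 : ℝ) 1, x ^ (m - 1) * (1 - x) ^ (n - 1)) := by
  have ipn := integrableOn_rpow_mul_one_sub_rpow hp hn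
  have imq := integrableOn_rpow_mul_one_sub_rpow hm hq
  have ipq := integrableOn_rpow_mul_one_sub_rpow hp hq
  have imn := integrableOn_rpow_mul_one_sub_rpow hm hn
  have weight_pos : ∀ a b : ℝ, ∀ x ∈ Ioo (0 : ℝ) 1, 0 < x ^ a * (1 - x) ^ b := fun a b x hx =>
    mul_pos (rpow_pos_of_pos hx.1 _) (rpow_pos_of_pos (sub_pos.2 hx.2) _)
  have split_p : ∀ x ∈ Ioo (0 : ℝ) 1, x ^ (p - 1) = x ^ (m - 1) * x ^ (p - m) := fun x hx => by
    rw [← rpow_add hx.1]; congr 1; ring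
  have split_q : ∀ x ∈ Ioo (0 : ℝ) 1,
      (1 - x) ^ (q - 1) = (1 - x) ^ (n - 1) * (1 - x) ^ (q - n) := fun x hx => by
    rw [← rpow_add (sub_pos.2 hx.2)]; congr 1; ring
  have hmn := setIntegral_Ioo_pos_of_pos_of_ne zero_lt_one 0 imn
    fun x hx _ => weight_pos _ _ x hx
  have hpn := setIntegral_Ioo_pos_of_pos_of_ne zero_lt_one 0 ipn
    fun x hx _ => weight_pos _ _ x hx
  have hlt := setIntegral_Ioo_pos_of_pos_of_ne zero_lt_one 0 (imn.sub ipn) fun x hx _ => by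
    have h := mul_pos (weight_pos (m - 1) (n - 1) x hx)
      (sub_pos.2 (rpow_lt_one hx.1.le hx.2 hpm))
    simp only [Pi.sub_apply, split_p x hx]
    linarith
  rw [integral_sub' imn ipn, sub_pos] at hlt
  -- `y` is the point where `x ^ (p - m)` equals its mean for the Beta distribution.
  obtain ⟨y, hy, hyc⟩ : ∃ y ∈ Ioo (0 : ℝ) 1, y ^ (p - m) =
      (∫ x in Ioo (0 : ℝ) 1, x ^ (p - 1) * (1 - x) ^ (n - 1)) /
        ∫ x in Ioo (0 : ℝ) 1, x ^ (m - 1) * (1 - x) ^ (n - 1) := by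
    have hc := div_pos hpn hmn
    exact ⟨_, ⟨rpow_pos_of_pos hc _, rpow_lt_one hc.le ((div_lt_one hmn).2 hlt) (inv_pos.2 hpm)⟩,
      rpow_inv_rpow hc.le hpm.ne'⟩
  set c := y ^ (p - m) with hc
  set d := (1 - y) ^ (q - n) with hd
  have hcov := setIntegral_Ioo_pos_of_pos_of_ne zero_lt_one y
    ((ipq.sub (imq.const_mul c)).sub ((ipn.sub (imn.const_mul c)).const_mul d)) fun x hx hxy => by
      have h := mul_pos (weight_pos (m - 1) (n - 1) x hx)
        (rpow_sub_mul_one_sub_rpow_sub_pos hpm hqn hx hy hxy)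
      simp only [Pi.sub_apply, split_p x hx, split_q x hx]
      rw [← hc, ← hd] at h
      linarith
  rw [integral_sub' (ipq.sub (imq.const_mul c)) ((ipn.sub (imn.const_mul c)).const_mul d),
    integral_sub' ipq (imq.const_mul c), integral_const_mul, integral_const_mul,
    integral_sub' ipn (imn.const_mul c), integral_const_mul] at hcov
  rw [eq_div_iff hmn.ne'] at hyc
  rw [hyc, sub_self, mul_zero, sub_zero, sub_pos] at hcov
  have h := mul_lt_mul_of_pos_right hcov hmn
  rw [← hyc]
  linarith
end

section
/- For every real number α with 1 < α < 2 and every real λ with 0 < λ < 1, the integral ∫₀^∞ ((1+x)^λ − 1 − λx) · (α(α−1)/Γ(2−α)) · x^{−1−α} dx converges and equals −λ · Γ(α−λ)/Γ(1−λ), where Γ denotes the real Gamma function. -/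
open Real MeasureTheory Set
open Filter Topology

theorem integral_Ioo_rpow_mul_one_sub_rpow {a b : ℝ} (ha : 0 < a) (hb : 0 < b) :
    ∫ x in Ioo (0 : ℝ) 1, x ^ (a - 1) * (1 - x) ^ (b - 1)
      = Real.Gamma a * Real.Gamma b / Real.Gamma (a + b) := by
  have hB := Complex.betaIntegral_eq_Gamma_mul_div a b (by simpa) (by simpa)
  rw [Complex.betaIntegral, intervalIntegral.integral_of_le zero_le_one,
    integral_Ioc_eq_integral_Ioo] at hB
  have hcongr : ∫ x in Ioo (0 : ℝ) 1, (x : ℂ) ^ ((a : ℂ) - 1) * (1 - (x : ℂ)) ^ ((b : ℂ) - 1)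
      = ∫ x in Ioo (0 : ℝ) 1, ((x ^ (a - 1) * (1 - x) ^ (b - 1) : ℝ) : ℂ) := by
    refine setIntegral_congr_fun measurableSet_Ioo fun x hx => ?_
    rw [Complex.ofReal_mul, Complex.ofReal_cpow hx.1.le, Complex.ofReal_cpow (by linarith [hx.2])]
    push_cast
    rfl
  rw [hcongr, integral_complex_ofReal, ← Complex.ofReal_add, Complex.Gamma_ofReal, Complex.Gamma_ofReal,
    Complex.Gamma_ofReal] at hB
  exact_mod_cast hB

theorem image_div_one_sub_Ioo : (fun t : ℝ => t / (1 - t)) '' Ioo 0 1 = Ioi 0 := by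
  ext x
  constructor
  · rintro ⟨t, ⟨h0, h1⟩, rfl⟩
    exact div_pos h0 (by linarith)
  · intro hx
    have hx : 0 < x := hx
    refine ⟨x / (1 + x), ⟨by positivity, (div_lt_one (by positivity)).2 (by linarith)⟩, ?_⟩
    field_simp
    ring

/-- The beta integral of the second kind. -/
theorem integral_Ioi_rpow_mul_one_add_rpow {a b : ℝ} (ha : 0 < a) (hb : 0 < b) :
    ∫ x in Ioi (0 : ℝ), x ^ (a - 1) * (1 + x) ^ (-(a + b))
      = Real.Gamma a * Real.Gamma b / Real.Gamma (a + b) := by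
  have hderiv : ∀ t ∈ Ioo (0 : ℝ) 1,
      HasDerivWithinAt (fun t : ℝ => t / (1 - t)) ((1 - t) ^ (-2 : ℝ)) (Ioo 0 1) t := by
    intro t ht
    have h1 : 0 < 1 - t := by linarith [ht.2]
    have h := (hasDerivAt_id t).div ((hasDerivAt_id t).const_sub 1) h1.ne'
    refine (h.congr_deriv ?_).hasDerivWithinAt
    rw [Real.rpow_neg h1.le, Real.rpow_two]
    simp only [id]
    field_simp
    ring
  have hinj : InjOn (fun t : ℝ => t / (1 - t)) (Ioo 0 1) := by
    intro s hs t ht hst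
    have hs1 : 1 - s ≠ 0 := by linarith [hs.2]
    have ht1 : 1 - t ≠ 0 := by linarith [ht.2]
    simp only at hst
    rw [div_eq_div_iff hs1 ht1] at hst
    linarith
  rw [← image_div_one_sub_Ioo,
    integral_image_eq_integral_abs_deriv_smul measurableSet_Ioo hderiv hinj,
    ← integral_Ioo_rpow_mul_one_sub_rpow ha hb]
  refine setIntegral_congr_fun measurableSet_Ioo fun t ht => ?_
  have h1 : 0 < 1 - t := by linarith [ht.2]
  have hadd : 1 + t / (1 - t) = (1 - t)⁻¹ := by field_simp; ring
  simp only [smul_eq_mul]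
  rw [hadd, abs_of_nonneg (by positivity), Real.div_rpow ht.1.le h1.le, Real.inv_rpow h1.le,
    ← Real.rpow_neg h1.le, div_eq_mul_inv, ← Real.rpow_neg h1.le]
  calc _ = t ^ (a - 1) * ((1 - t) ^ (-2 : ℝ) * (1 - t) ^ (-(a - 1)) * (1 - t) ^ (-(-(a + b)))) := by
        ring
    _ = _ := by
        rw [← Real.rpow_add h1, ← Real.rpow_add h1]
        congr 2
        ring

theorem integrableOn_Ioi_of_abs_le_rpow {g : ℝ → ℝ} {p q C D : ℝ} (hp : -1 < p) (hq : q < -1)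
    (hg : ContinuousOn g (Ioi 0)) (h0 : ∀ x, 0 < x → |g x| ≤ C * x ^ p)
    (h1 : ∀ x, 0 < x → |g x| ≤ D * x ^ q) : IntegrableOn g (Ioi 0) := by
  rw [← Ioc_union_Ioi_eq_Ioi zero_le_one]
  refine IntegrableOn.union ?_ ?_
  · have hint : IntegrableOn (fun x : ℝ => C * x ^ p) (Ioc 0 1) :=
      ((intervalIntegrable_iff_integrableOn_Ioc_of_le zero_le_one).1
        (intervalIntegral.intervalIntegrable_rpow' hp)).const_mul C
    refine hint.mono' ((hg.mono Ioc_subset_Ioi_self).aestronglyMeasurable measurableSet_Ioc) ?_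
    exact (ae_restrict_mem measurableSet_Ioc).mono fun x hx => h0 x hx.1
  · have hint : IntegrableOn (fun x : ℝ => D * x ^ q) (Ioi 1) :=
      (integrableOn_Ioi_rpow_of_lt hq one_pos).const_mul D
    refine hint.mono' ((hg.mono (Ioi_subset_Ioi zero_le_one)).aestronglyMeasurable
      measurableSet_Ioi) ?_
    exact (ae_restrict_mem measurableSet_Ioi).mono fun x hx => h1 x (one_pos.trans hx)

section Bounds

variable {lam x : ℝ}

theorem abs_one_add_rpow_sub_one_le_mul (h0 : 0 < lam) (h1 : lam < 1) (hx : 0 ≤ x) :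
    |(1 + x) ^ (lam - 1) - 1| ≤ x := by
  have hle : (1 + x) ^ (lam - 1) ≤ 1 :=
    Real.rpow_le_one_of_one_le_of_nonpos (by linarith) (by linarith)
  have hB := rpow_one_add_le_one_add_mul_self (s := x) (by linarith) (p := 1 - lam)
    (by linarith) (by linarith)
  have hmul : (1 + x) ^ (lam - 1) * (1 + x) ^ (1 - lam) = 1 := by
    rw [← Real.rpow_add (by linarith)]
    simp
  have hpos : 0 < (1 + x) ^ (lam - 1) := by positivity
  have hlow : 1 ≤ (1 + x) ^ (lam - 1) * (1 + (1 - lam) * x) :=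
    hmul.symm.le.trans (mul_le_mul_of_nonneg_left hB hpos.le)
  have hup : (1 + x) ^ (lam - 1) * ((1 - lam) * x) ≤ 1 * (1 * x) := by
    have := sub_pos.2 h1
    gcongr
    linarith
  rw [abs_le]
  constructor <;> linarith

theorem abs_one_add_rpow_sub_one_le_one (h1 : lam < 1) (hx : 0 ≤ x) :
    |(1 + x) ^ (lam - 1) - 1| ≤ 1 := by
  have hle : (1 + x) ^ (lam - 1) ≤ 1 :=
    Real.rpow_le_one_of_one_le_of_nonpos (by linarith) (by linarith)
  have hpos : 0 < (1 + x) ^ (lam - 1) := by positivity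
  rw [abs_le]
  constructor <;> linarith

theorem abs_one_add_rpow_sub_sub_le_self (h0 : 0 < lam) (h1 : lam < 1) (hx : 0 ≤ x) :
    |(1 + x) ^ lam - 1 - lam * x| ≤ x := by
  have hB := rpow_one_add_le_one_add_mul_self (s := x) (by linarith) h0.le h1.le
  have hle : 1 ≤ (1 + x) ^ lam := Real.one_le_rpow (by linarith) h0.le
  rw [abs_le]
  constructor <;> nlinarith

theorem abs_one_add_rpow_sub_sub_le_sq (h0 : 0 < lam) (h1 : lam < 1) (hx : 0 ≤ x) :
    |(1 + x) ^ lam - 1 - lam * x| ≤ x ^ 2 := by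
  have hB := rpow_one_add_le_one_add_mul_self (s := x) (by linarith) h0.le h1.le
  have hB' := rpow_one_add_le_one_add_mul_self (s := x) (by linarith) (p := 1 - lam)
    (by linarith) (by linarith)
  have hmul : (1 + x) ^ lam * (1 + x) ^ (1 - lam) = 1 + x := by
    rw [← Real.rpow_add (by linarith)]
    simp
  have hpos : 0 < (1 + x) ^ lam := by positivity
  have hy : 0 < 1 + (1 - lam) * x := by nlinarith
  have hlow : 1 + x ≤ (1 + x) ^ lam * (1 + (1 - lam) * x) := by nlinarith
  have hkey : (1 + x) * (1 - (1 - lam) * x) * (1 + (1 - lam) * x) ≤ 1 + x := by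
    nlinarith [mul_nonneg (by linarith : 0 ≤ 1 + x) (sq_nonneg ((1 - lam) * x))]
  have hle : (1 + x) * (1 - (1 - lam) * x) ≤ (1 + x) ^ lam :=
    le_of_mul_le_mul_right (hkey.trans hlow) hy
  rw [abs_le]
  constructor <;> nlinarith [sq_nonneg x]

end Bounds

/-- The function vanishing at both ends of `(0, ∞)` whose derivative encodes two integrations by
parts. -/
noncomputable def boundaryTerm (α lam x : ℝ) : ℝ :=
  -((α - 1) * (((1 + x) ^ lam - 1 - lam * x) * x ^ (-α))
    + lam * (((1 + x) ^ (lam - 1) - 1) * x ^ (1 - α)))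

theorem hasDerivAt_boundaryTerm (α lam : ℝ) {x : ℝ} (hx : 0 < x) :
    HasDerivAt (boundaryTerm α lam)
      (α * (α - 1) * (((1 + x) ^ lam - 1 - lam * x) * x ^ (-1 - α))
        - lam * (lam - 1) * (x ^ (1 - α) * (1 + x) ^ (lam - 2))) x := by
  have hx1 : 1 + x ≠ 0 := by positivity
  have hid := (hasDerivAt_id' x).const_add 1
  have hf := ((hid.rpow_const (p := lam) (.inl hx1)).sub_const 1).sub
    ((hasDerivAt_id' x).const_mul lam)
  have hf' := (hid.rpow_const (p := lam - 1) (.inl hx1)).sub_const 1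
  have h1 := hf.mul (Real.hasDerivAt_rpow_const (p := -α) (.inl hx.ne'))
  have h2 := hf'.mul (Real.hasDerivAt_rpow_const (p := 1 - α) (.inl hx.ne'))
  refine (((h1.const_mul (α - 1)).add (h2.const_mul lam)).neg).congr_deriv ?_
  rw [show -α - 1 = -1 - α by ring, show 1 - α - 1 = -α by ring,
    show lam - 1 - 1 = lam - 2 by ring]
  simp only [Pi.sub_apply]
  ring

theorem abs_boundaryTerm_le {α lam x p : ℝ} (hα : 1 < α) (h0 : 0 < lam) (hx : 0 < x)
    (h : |(1 + x) ^ lam - 1 - lam * x| ≤ x ^ (p + 1)) (h' : |(1 + x) ^ (lam - 1) - 1| ≤ x ^ p) :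
    |boundaryTerm α lam x| ≤ (α - 1 + lam) * x ^ (p + 1 - α) := by
  have e1 : x ^ (p + 1 - α) = x ^ (p + 1) * x ^ (-α) := by
    rw [← Real.rpow_add hx]; ring_nf
  have e2 : x ^ (p + 1 - α) = x ^ p * x ^ (1 - α) := by
    rw [← Real.rpow_add hx]; ring_nf
  rw [boundaryTerm, abs_neg]
  refine (abs_add_le _ _).trans ?_
  rw [add_mul (α - 1) lam]
  refine add_le_add ?_ ?_
  · rw [abs_mul, abs_mul, abs_of_pos (sub_pos.2 hα), abs_of_pos (Real.rpow_pos_of_pos hx _), e1]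
    have := sub_pos.2 hα
    gcongr
  · rw [abs_mul, abs_mul, abs_of_pos h0, abs_of_pos (Real.rpow_pos_of_pos hx _), e2]
    gcongr

theorem tendsto_boundaryTerm_atTop {α lam : ℝ} (hα : 1 < α) (h0 : 0 < lam) (h1 : lam < 1) :
    Tendsto (boundaryTerm α lam) atTop (𝓝 0) := by
  have hlim : Tendsto (fun x : ℝ => (α - 1 + lam) * x ^ (0 + 1 - α)) atTop (𝓝 0) := by
    have := (tendsto_rpow_neg_atTop (sub_pos.2 hα)).const_mul (α - 1 + lam)
    simpa [neg_sub] using this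
  refine squeeze_zero_norm' ?_ hlim
  filter_upwards [eventually_gt_atTop 0] with x hx
  refine abs_boundaryTerm_le hα h0 hx ?_ ?_
  · simpa using abs_one_add_rpow_sub_sub_le_self h0 h1 hx.le
  · simpa using abs_one_add_rpow_sub_one_le_one h1 hx.le

theorem boundaryTerm_zero (α lam : ℝ) : boundaryTerm α lam 0 = 0 := by
  simp [boundaryTerm]

theorem continuousWithinAt_boundaryTerm_zero {α lam : ℝ} (hα₁ : 1 < α) (hα₂ : α < 2)
    (h0 : 0 < lam) (h1 : lam < 1) : ContinuousWithinAt (boundaryTerm α lam) (Ici 0) 0 := by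
  have hlim : Tendsto (fun x : ℝ => (α - 1 + lam) * x ^ (1 + 1 - α)) (𝓝[≥] 0) (𝓝 0) := by
    have hc : ContinuousAt (fun x : ℝ => (α - 1 + lam) * x ^ (1 + 1 - α)) 0 :=
      (Real.continuousAt_rpow_const _ _ (.inr (by linarith))).const_mul _
    have := hc.tendsto
    rw [Real.zero_rpow (by linarith), mul_zero] at this
    exact this.mono_left nhdsWithin_le_nhds
  rw [ContinuousWithinAt, boundaryTerm_zero]
  refine squeeze_zero_norm' ?_ hlim
  filter_upwards [self_mem_nhdsWithin] with x hx
  rcases (mem_Ici.1 hx).eq_or_lt with rfl | hx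
  · rw [boundaryTerm_zero, Real.zero_rpow (by linarith)]
    simp
  refine abs_boundaryTerm_le hα₁ h0 hx ?_ ?_
  · rw [one_add_one_eq_two, Real.rpow_two]
    exact abs_one_add_rpow_sub_sub_le_sq h0 h1 hx.le
  · simpa using abs_one_add_rpow_sub_one_le_mul h0 h1 hx.le

theorem integrableOn_one_add_rpow_sub_sub_mul {α lam : ℝ} (hα₁ : 1 < α) (hα₂ : α < 2)
    (h0 : 0 < lam) (h1 : lam < 1) :
    IntegrableOn (fun x : ℝ => ((1 + x) ^ lam - 1 - lam * x) * x ^ (-1 - α)) (Ioi 0) := by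
  refine integrableOn_Ioi_of_abs_le_rpow (p := 1 - α) (q := -α) (C := 1) (D := 1)
    (by linarith) (by linarith) ?_ ?_ ?_
  · intro x hx
    have hx : 0 < x := hx
    refine ContinuousAt.continuousWithinAt ?_
    have hx1 : 1 + x ≠ 0 := by positivity
    fun_prop (disch := simp [hx.ne', hx1])
  · intro x hx
    have hsplit : x ^ (1 - α) = x ^ 2 * x ^ (-1 - α) := by
      rw [← Real.rpow_two, ← Real.rpow_add hx]
      ring_nf
    rw [abs_mul, abs_of_pos (Real.rpow_pos_of_pos hx _), one_mul, hsplit]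
    gcongr
    exact abs_one_add_rpow_sub_sub_le_sq h0 h1 hx.le
  · intro x hx
    have hsplit : x ^ (-α) = x * x ^ (-1 - α) := by
      rw [← Real.rpow_one_add' hx.le (by linarith)]
      ring_nf
    rw [abs_mul, abs_of_pos (Real.rpow_pos_of_pos hx _), one_mul, hsplit]
    gcongr
    exact abs_one_add_rpow_sub_sub_le_self h0 h1 hx.le

theorem integrableOn_rpow_mul_one_add_rpow {α lam : ℝ} (hα₁ : 1 < α) (hα₂ : α < 2)
    (h1 : lam < 1) :
    IntegrableOn (fun x : ℝ => x ^ (1 - α) * (1 + x) ^ (lam - 2)) (Ioi 0) := by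
  refine integrableOn_Ioi_of_abs_le_rpow (p := 1 - α) (q := 1 - α + (lam - 2)) (C := 1) (D := 1)
    (by linarith) (by linarith) ?_ ?_ ?_
  · intro x hx
    have hx : 0 < x := hx
    refine ContinuousAt.continuousWithinAt ?_
    have hx1 : 1 + x ≠ 0 := by positivity
    fun_prop (disch := simp [hx.ne', hx1])
  · intro x hx
    rw [abs_of_nonneg (by positivity), mul_comm]
    gcongr
    exact Real.rpow_le_one_of_one_le_of_nonpos (by linarith) (by linarith)
  · intro x hx
    rw [abs_of_nonneg (by positivity), Real.rpow_add hx, one_mul]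
    exact mul_le_mul_of_nonneg_left
      (Real.rpow_le_rpow_of_nonpos hx (by linarith) (by linarith)) (by positivity)

theorem integral_one_add_rpow_sub_sub_mul {α lam : ℝ} (hα₁ : 1 < α) (hα₂ : α < 2)
    (h0 : 0 < lam) (h1 : lam < 1) :
    α * (α - 1) * ∫ x in Ioi (0 : ℝ), ((1 + x) ^ lam - 1 - lam * x) * x ^ (-1 - α)
      = lam * (lam - 1) *
        (Real.Gamma (2 - α) * Real.Gamma (α - lam) / Real.Gamma (2 - lam)) := by
  have hI := (integrableOn_one_add_rpow_sub_sub_mul hα₁ hα₂ h0 h1).const_mul (α * (α - 1))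
  have hJ := (integrableOn_rpow_mul_one_add_rpow hα₁ hα₂ h1).const_mul (lam * (lam - 1))
  have hFTC := integral_Ioi_of_hasDerivAt_of_tendsto
    (continuousWithinAt_boundaryTerm_zero hα₁ hα₂ h0 h1)
    (fun x hx => hasDerivAt_boundaryTerm α lam hx) (hI.sub hJ) (tendsto_boundaryTerm_atTop hα₁ h0 h1)
  rw [integral_sub hI hJ, integral_const_mul, integral_const_mul, boundaryTerm_zero, sub_zero,
    sub_eq_zero] at hFTC
  have hB := integral_Ioi_rpow_mul_one_add_rpow (a := 2 - α) (b := α - lam)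
    (by linarith) (by linarith)
  rw [show 2 - α - 1 = 1 - α by ring, show 2 - α + (α - lam) = 2 - lam by ring, neg_sub] at hB
  rw [hFTC, hB]

theorem stmt_4 (α lam : ℝ) (hα₁ : 1 < α) (hα₂ : α < 2) (hlam₁ : 0 < lam) (hlam₂ : lam < 1) :
    IntegrableOn
      (fun x : ℝ => ((1 + x) ^ lam - 1 - lam * x) *
        (α * (α - 1) / Real.Gamma (2 - α)) * x ^ (-1 - α)) (Ioi 0) volume ∧
    ∫ x in Ioi (0 : ℝ),
        ((1 + x) ^ lam - 1 - lam * x) * (α * (α - 1) / Real.Gamma (2 - α)) * x ^ (-1 - α)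
      = -lam * (Real.Gamma (α - lam) / Real.Gamma (1 - lam)) := by
  simp only [mul_right_comm _ (α * (α - 1) / Real.Gamma (2 - α))]
  refine ⟨(integrableOn_one_add_rpow_sub_sub_mul hα₁ hα₂ hlam₁ hlam₂).mul_const _, ?_⟩
  have hint := integral_one_add_rpow_sub_sub_mul hα₁ hα₂ hlam₁ hlam₂
  have hΓ : Real.Gamma (2 - lam) = (1 - lam) * Real.Gamma (1 - lam) := by
    rw [← Real.Gamma_add_one (by linarith)]
    ring_nf
  have hΓα : Real.Gamma (2 - α) ≠ 0 := (Real.Gamma_pos_of_pos (by linarith)).ne'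
  have hΓlam : Real.Gamma (1 - lam) ≠ 0 := (Real.Gamma_pos_of_pos (by linarith)).ne'
  have hlam : 1 - lam ≠ 0 := by linarith
  rw [integral_mul_const, mul_div_assoc', mul_comm _ (α * (α - 1)), hint, hΓ]
  field_simp
  ring
end

section
/- Let α be a real number with 1 < α < 2 and let θ ≥ 0 be real. Then there exists λ ∈ (0,1) with θ < Γ(α−λ)/Γ(1−λ) if and only if θ < Γ(α), where Γ denotes the real Gamma function. -/
open Set

/-- Log-convexity of the Gamma function, as a majorization inequality: of two pairs of positive
reals with the same sum, the more spread out one has the larger product of Gamma values. -/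
lemma Gamma_mul_Gamma_le_of_convex {x y a b : ℝ} (hx : 0 < x) (hy : 0 < y) (ha : 0 < a)
    (hb : 0 < b) (hab : a + b = 1) :
    Real.Gamma (a * x + b * y) * Real.Gamma (b * x + a * y) ≤ Real.Gamma x * Real.Gamma y := by
  have h₁ := Real.Gamma_mul_add_mul_le_rpow_Gamma_mul_rpow_Gamma hx hy ha hb hab
  have h₂ := Real.Gamma_mul_add_mul_le_rpow_Gamma_mul_rpow_Gamma hx hy hb ha (by linarith)
  have hGx := Real.Gamma_pos_of_pos hx
  have hGy := Real.Gamma_pos_of_pos hy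
  have hpos : 0 < Real.Gamma (b * x + a * y) := Real.Gamma_pos_of_pos (by positivity)
  calc _ ≤ (Real.Gamma x ^ a * Real.Gamma y ^ b) * (Real.Gamma x ^ b * Real.Gamma y ^ a) :=
        mul_le_mul h₁ h₂ hpos.le (by positivity)
    _ = (Real.Gamma x ^ a * Real.Gamma x ^ b) * (Real.Gamma y ^ a * Real.Gamma y ^ b) := by ring
    _ = Real.Gamma x * Real.Gamma y := by
        rw [← Real.rpow_add hGx, ← Real.rpow_add hGy, hab, Real.rpow_one, Real.rpow_one]

lemma Gamma_sub_div_Gamma_one_sub_le {α lam : ℝ} (hα : 1 < α) (hlam : lam ∈ Ioo (0 : ℝ) 1) :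
    Real.Gamma (α - lam) / Real.Gamma (1 - lam) ≤ Real.Gamma α := by
  obtain ⟨h₀, h₁⟩ := hlam
  have hD : 0 < α - 1 + lam := by linarith
  have h := Gamma_mul_Gamma_le_of_convex (x := 1 - lam) (y := α)
    (a := (α - 1) / (α - 1 + lam)) (b := lam / (α - 1 + lam)) (by linarith) (by linarith)
    (div_pos (by linarith) hD) (div_pos h₀ hD) (by field_simp)
  have e₁ : (α - 1) / (α - 1 + lam) * (1 - lam) + lam / (α - 1 + lam) * α = 1 := by
    field_simp; ring
  have e₂ : lam / (α - 1 + lam) * (1 - lam) + (α - 1) / (α - 1 + lam) * α = α - lam := by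
    field_simp; ring
  rw [e₁, e₂, Real.Gamma_one, one_mul, mul_comm] at h
  exact (div_le_iff₀ (Real.Gamma_pos_of_pos (by linarith))).2 h

lemma continuousAt_Gamma_of_pos {x : ℝ} (hx : 0 < x) : ContinuousAt Real.Gamma x :=
  (Real.differentiableAt_Gamma fun m => by
    have : (0 : ℝ) ≤ m := m.cast_nonneg
    linarith).continuousAt

theorem stmt_7 (α θ : ℝ) (hα₁ : 1 < α) (hα₂ : α < 2) (hθ : 0 ≤ θ) :
    (∃ lam ∈ Ioo (0 : ℝ) 1, θ < Real.Gamma (α - lam) / Real.Gamma (1 - lam)) ↔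
      θ < Real.Gamma α := by
  constructor
  · rintro ⟨lam, hlam, h⟩
    exact h.trans_le (Gamma_sub_div_Gamma_one_sub_le hα₁ hlam)
  · intro h
    have hsub : ∀ c : ℝ, 0 < c → ContinuousAt (fun lam : ℝ => Real.Gamma (c - lam)) 0 :=
      fun c hc => ContinuousAt.comp (f := fun lam : ℝ => c - lam)
        (continuousAt_Gamma_of_pos (by simpa using hc)) (by fun_prop)
    have hcont : ContinuousAt
        (fun lam : ℝ => Real.Gamma (α - lam) / Real.Gamma (1 - lam)) 0 :=
      (hsub α (by linarith)).div (hsub 1 one_pos) (by simp)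
    have hev := hcont.eventually (lt_mem_nhds (a := θ) (by simpa using h))
    obtain ⟨lam, hlt, hlam⟩ :=
      ((hev.filter_mono nhdsWithin_le_nhds).and
        (Ioo_mem_nhdsGT (zero_lt_one (α := ℝ)))).exists
    exact ⟨lam, hlam, hlt⟩
end

section
/- Let α be a real number with 1 < α < 2, let β ∈ (1−1/α, 1), set η := 1 − α(1−β) ∈ (0,1), and let θ ≥ 0 be real. Then there exists λ ∈ (0, 1−η) with θ > Γ(α−λ)/Γ(1−λ) if and only if θ > Γ(αβ)/Γ(η), where Γ denotes the real Gamma function. (Note α − (1−η) = αβ.) -/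
open Set

/-- By log-convexity of `Gamma`, the ratio `Γ (x + s) / Γ x` is nondecreasing in `x > 0`. -/
theorem gamma_add_div_gamma_le {x y s : ℝ} (hx : 0 < x) (hxy : x < y) (hs : 0 < s) :
    Real.Gamma (x + s) / Real.Gamma x ≤ Real.Gamma (y + s) / Real.Gamma y := by
  have hy : 0 < y := hx.trans hxy
  have hT : 0 < y + s - x := by linarith
  have ha : 0 < (y - x) / (y + s - x) := div_pos (by linarith) hT
  have hb : 0 < s / (y + s - x) := div_pos hs hT
  have hab : (y - x) / (y + s - x) + s / (y + s - x) = 1 := by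
    field_simp
    ring
  have h₁ := Real.Gamma_mul_add_mul_le_rpow_Gamma_mul_rpow_Gamma hx
    (show 0 < y + s by linarith) ha hb hab
  have h₂ := Real.Gamma_mul_add_mul_le_rpow_Gamma_mul_rpow_Gamma hx
    (show 0 < y + s by linarith) hb ha (by rw [add_comm, hab])
  have e₁ : (y - x) / (y + s - x) * x + s / (y + s - x) * (y + s) = x + s := by
    field_simp
    ring
  have e₂ : s / (y + s - x) * x + (y - x) / (y + s - x) * (y + s) = y := by
    field_simp
    ring
  rw [e₁] at h₁
  rw [e₂] at h₂
  have gx := Real.Gamma_pos_of_pos hx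
  have gy := Real.Gamma_pos_of_pos hy
  have gys : 0 < Real.Gamma (y + s) := Real.Gamma_pos_of_pos (by linarith)
  rw [div_le_div_iff₀ gx gy]
  refine (mul_le_mul h₁ h₂ gy.le (by positivity)).trans_eq ?_
  rw [mul_mul_mul_comm, ← Real.rpow_add gx, ← Real.rpow_add gys, hab, add_comm (s / _), hab,
    Real.rpow_one, Real.rpow_one, mul_comm]

theorem stmt_8 (α β η θ : ℝ) (hα₁ : 1 < α) (hα₂ : α < 2) (hβ₁ : 1 - 1 / α < β) (hβ₂ : β < 1)
    (hη : η = 1 - α * (1 - β)) (hθ : 0 ≤ θ) :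
    (∃ lam ∈ Ioo (0 : ℝ) (1 - η), Real.Gamma (α - lam) / Real.Gamma (1 - lam) < θ) ↔
      Real.Gamma (α * β) / Real.Gamma η < θ := by
  have hη₀ : 0 < η := by
    have h := mul_lt_mul_of_pos_left hβ₁ (show 0 < α by linarith)
    rw [mul_sub, mul_one_div_cancel (by linarith)] at h
    linarith
  have hη₁ : η < 1 := by
    have := mul_pos (show 0 < α by linarith) (show 0 < 1 - β by linarith)
    linarith
  have hαβ : α * β = η + (α - 1) := by rw [hη]; ring
  rw [hαβ]
  constructor
  · rintro ⟨l, ⟨-, hl⟩, h⟩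
    refine (gamma_add_div_gamma_le hη₀ (show η < 1 - l by linarith)
      (show 0 < α - 1 by linarith)).trans_lt ?_
    rwa [show 1 - l + (α - 1) = α - l by ring]
  · intro h
    have hΓ : ∀ {z : ℝ}, 0 < z → ContinuousAt Real.Gamma z := fun hz =>
      Real.differentiableOn_Gamma_Ioi.continuousOn.continuousAt (Ioi_mem_nhds hz)
    have hcont : ContinuousAt (fun x => Real.Gamma (x + (α - 1)) / Real.Gamma x) η :=
      (ContinuousAt.comp (f := fun x : ℝ => x + (α - 1)) (hΓ (by linarith))
        (by fun_prop)).div (hΓ hη₀) (Real.Gamma_pos_of_pos hη₀).ne'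
    obtain ⟨x, hx, hx₀, hx₁⟩ := (((hcont.eventually_lt_const h).filter_mono
      nhdsWithin_le_nhds).and (Ioo_mem_nhdsGT hη₁)).exists
    refine ⟨1 - x, ⟨by linarith, by linarith⟩, ?_⟩
    rwa [show α - (1 - x) = x + (α - 1) by ring, sub_sub_cancel]
end

section
/- For every real number α with 1 < α < 2, the function λ ↦ −λ · Γ(α−λ)/Γ(1−λ) is convex on the interval [0,1), where Γ denotes the real Gamma function. -/
open Set

/-- Partial fraction expansion of a product whose simple zeros and poles interlace:
all residues are nonpositive. -/
theorem exists_prod_div_eq_one_sub_sum {β : ℝ} (hβ₀ : 0 < β) (hβ₁ : β < 1) (n : ℕ) :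
    ∃ c : ℕ → ℝ, (∀ k, 0 ≤ c k) ∧ ∀ s : ℝ, 0 < s →
      ∏ k ∈ Finset.range n, (s + k) / (s + β + k) =
        1 - ∑ k ∈ Finset.range n, c k * (s + β + k)⁻¹ := by
  induction n with
  | zero => exact ⟨0, by simp, by simp⟩
  | succ n ih =>
    obtain ⟨c, hc, h⟩ := ih
    have gap : ∀ k ∈ Finset.range n, (1 : ℝ) ≤ n - k := by
      intro k hk
      have : ((k + 1 : ℕ) : ℝ) ≤ n := by exact_mod_cast Finset.mem_range.1 hk
      push_cast at this
      linarith
    set d : ℝ := β + ∑ k ∈ Finset.range n, c k * (β / (n - k)) with hd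
    have hd₀ : 0 ≤ d := by
      refine add_nonneg hβ₀.le (Finset.sum_nonneg fun k hk => ?_)
      exact mul_nonneg (hc k) (div_nonneg hβ₀.le (by linarith [gap k hk]))
    refine ⟨fun k => if k < n then c k * ((n - k - β) / (n - k)) else d, fun k => ?_,
      fun s hs => ?_⟩
    · dsimp only
      split_ifs with hk
      · have := gap k (Finset.mem_range.2 hk)
        exact mul_nonneg (hc k) (div_nonneg (by linarith) (by linarith))
      · exact hd₀
    · rw [Finset.prod_range_succ, h s hs, Finset.sum_range_succ]
      have hn : s + β + n ≠ 0 := by positivity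
      have hsum : ∑ k ∈ Finset.range n,
          (if k < n then c k * (((n : ℝ) - k - β) / (n - k)) else d) * (s + β + k)⁻¹ =
          ∑ k ∈ Finset.range n, (c k * (s + β + k)⁻¹ * ((s + n) / (s + β + n)) -
            c k * (β / (n - k)) * (s + β + n)⁻¹) := by
        refine Finset.sum_congr rfl fun k hk => ?_
        rw [if_pos (Finset.mem_range.1 hk)]
        have hk₁ : (n : ℝ) - k ≠ 0 := by linarith [gap k hk]
        have hk₂ : s + β + k ≠ 0 := by positivity
        field_simp
        ring
      rw [hsum, Finset.sum_sub_distrib, ← Finset.sum_mul, ← Finset.sum_mul]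
      simp only [lt_irrefl, if_false]
      rw [hd]
      generalize ∑ k ∈ Finset.range n, c k * (s + β + k)⁻¹ = S
      generalize ∑ k ∈ Finset.range n, c k * (β / (n - k)) = T
      field_simp
      ring

theorem concaveOn_one_sub_sum_inv {β : ℝ} (hβ : 0 < β) {c : ℕ → ℝ} (hc : ∀ k, 0 ≤ c k)
    (n : ℕ) : ConcaveOn ℝ (Ioi 0)
      (fun s : ℝ => 1 - ∑ k ∈ Finset.range n, c k * (s + β + k)⁻¹) := by
  have hinv : ConvexOn ℝ (Ioi 0) fun x : ℝ => x⁻¹ := by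
    simpa using convexOn_zpow (𝕜 := ℝ) (-1)
  refine ⟨convex_Ioi 0, fun x hx y hy a b ha hb hab => ?_⟩
  have hx' : 0 < x := hx
  have hy' : 0 < y := hy
  have key : ∑ k ∈ Finset.range n, c k * (a * x + b * y + β + k)⁻¹ ≤
      a * ∑ k ∈ Finset.range n, c k * (x + β + k)⁻¹ +
        b * ∑ k ∈ Finset.range n, c k * (y + β + k)⁻¹ := by
    rw [Finset.mul_sum, Finset.mul_sum, ← Finset.sum_add_distrib]
    refine Finset.sum_le_sum fun k _ => ?_
    have h := hinv.2 (x := x + β + k) (mem_Ioi.2 (by positivity))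
      (y := y + β + k) (mem_Ioi.2 (by positivity)) ha hb hab
    simp only [smul_eq_mul] at h
    have e : a * (x + β + k) + b * (y + β + k) = a * x + b * y + β + k := by
      linear_combination (β + k) * hab
    rw [e] at h
    nlinarith [mul_le_mul_of_nonneg_left h (hc k)]
  simp only [smul_eq_mul]
  nlinarith [key, hab]

theorem monotoneOn_one_sub_sum_inv {β : ℝ} (hβ : 0 < β) {c : ℕ → ℝ} (hc : ∀ k, 0 ≤ c k)
    (n : ℕ) : MonotoneOn
      (fun s : ℝ => 1 - ∑ k ∈ Finset.range n, c k * (s + β + k)⁻¹) (Ioi 0) := by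
  intro x hx y hy hxy
  have hx' : 0 < x := hx
  refine sub_le_sub_left (Finset.sum_le_sum fun k _ => ?_) 1
  have := hc k
  gcongr

/-- A Gauss-type product formula for a ratio of Gamma values. -/
theorem tendsto_rpow_mul_prod_Gamma_div {β s : ℝ} (hβ : 0 < β) (hs : 0 < s) :
    Filter.Tendsto
      (fun n : ℕ => (n : ℝ) ^ β * ∏ k ∈ Finset.range (n + 1), (s + k) / (s + β + k))
      Filter.atTop (nhds (Real.Gamma (s + β) / Real.Gamma s)) := by
  refine ((Real.GammaSeq_tendsto_Gamma (s + β)).div (Real.GammaSeq_tendsto_Gamma s)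
    (Real.Gamma_pos_of_pos hs).ne').congr' ?_
  filter_upwards [Filter.eventually_gt_atTop 0] with n hn
  have hn' : (0 : ℝ) < n := by exact_mod_cast hn
  have h₁ : ∏ k ∈ Finset.range (n + 1), (s + k) ≠ 0 :=
    (Finset.prod_pos fun k _ => by positivity).ne'
  have h₂ : ∏ k ∈ Finset.range (n + 1), (s + β + k) ≠ 0 :=
    (Finset.prod_pos fun k _ => by positivity).ne'
  have h₃ : (n : ℝ) ^ s ≠ 0 := (Real.rpow_pos_of_pos hn' s).ne'
  have h₄ : (n.factorial : ℝ) ≠ 0 := by positivity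
  simp only [Pi.div_apply, Real.GammaSeq, Finset.prod_div_distrib, Real.rpow_add hn']
  field_simp

theorem concaveOn_Gamma_add_div_Gamma {β : ℝ} (hβ₀ : 0 < β) (hβ₁ : β < 1) :
    ConcaveOn ℝ (Ioi 0) (fun s : ℝ => Real.Gamma (s + β) / Real.Gamma s) := by
  refine ⟨convex_Ioi 0, fun x hx y hy a b ha hb hab => ?_⟩
  have hz : a • x + b • y ∈ Ioi (0 : ℝ) := convex_Ioi 0 hx hy ha hb hab
  refine le_of_tendsto_of_tendsto'
    (((tendsto_rpow_mul_prod_Gamma_div hβ₀ hx).const_smul a).add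
      ((tendsto_rpow_mul_prod_Gamma_div hβ₀ hy).const_smul b))
    (tendsto_rpow_mul_prod_Gamma_div hβ₀ hz) fun n => ?_
  obtain ⟨c, hc, h⟩ := exists_prod_div_eq_one_sub_sum hβ₀ hβ₁ (n + 1)
  rw [h x hx, h y hy, h _ hz]
  have hp : (0 : ℝ) ≤ (n : ℝ) ^ β := by positivity
  exact ((concaveOn_one_sub_sum_inv hβ₀ hc (n + 1)).smul hp).2 hx hy ha hb hab

theorem monotoneOn_Gamma_add_div_Gamma {β : ℝ} (hβ₀ : 0 < β) (hβ₁ : β < 1) :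
    MonotoneOn (fun s : ℝ => Real.Gamma (s + β) / Real.Gamma s) (Ioi 0) := by
  intro x hx y hy hxy
  refine le_of_tendsto_of_tendsto' (tendsto_rpow_mul_prod_Gamma_div hβ₀ hx)
    (tendsto_rpow_mul_prod_Gamma_div hβ₀ hy) fun n => ?_
  obtain ⟨c, hc, h⟩ := exists_prod_div_eq_one_sub_sum hβ₀ hβ₁ (n + 1)
  rw [h x hx, h y hy]
  exact mul_le_mul_of_nonneg_left
    (monotoneOn_one_sub_sum_inv hβ₀ hc (n + 1) hx hy hxy) (by positivity)

theorem stmt_9 (α : ℝ) (hα₁ : 1 < α) (hα₂ : α < 2) :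
    ConvexOn ℝ (Ico (0 : ℝ) 1)
      (fun lam : ℝ => -(lam * (Real.Gamma (α - lam) / Real.Gamma (1 - lam)))) := by
  have hβ₀ : 0 < α - 1 := by linarith
  have hβ₁ : α - 1 < 1 := by linarith
  have shift : ∀ x : ℝ, α - x = 1 - x + (α - 1) := fun x => by ring
  have hpos : ∀ x ∈ Ico (0 : ℝ) 1, 1 - x ∈ Ioi (0 : ℝ) := fun x hx => sub_pos.2 hx.2
  have hconc : ConcaveOn ℝ (Ico (0 : ℝ) 1)
      (fun x : ℝ => Real.Gamma (α - x) / Real.Gamma (1 - x)) := by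
    refine ⟨convex_Ico 0 1, fun x hx y hy a b ha hb hab => ?_⟩
    have h := (concaveOn_Gamma_add_div_Gamma hβ₀ hβ₁).2 (hpos x hx) (hpos y hy) ha hb hab
    have e : a • (1 - x) + b • (1 - y) = 1 - (a • x + b • y) := by
      simp only [smul_eq_mul]
      linear_combination hab
    simpa only [e, ← shift] using h
  have hanti : AntitoneOn (fun x : ℝ => Real.Gamma (α - x) / Real.Gamma (1 - x))
      (Ico (0 : ℝ) 1) := by
    intro x hx y hy hxy
    have h := monotoneOn_Gamma_add_div_Gamma hβ₀ hβ₁ (hpos y hy) (hpos x hx)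
      (sub_le_sub_left hxy 1)
    simpa only [← shift] using h
  refine ((concaveOn_id (convex_Ico 0 1)).mul hconc (fun x hx => hx.1) (fun x hx => ?_)
    ((monotoneOn_id).antivaryOn hanti)).neg
  have := hx.2
  exact div_nonneg (Real.Gamma_pos_of_pos (by linarith)).le
    (Real.Gamma_pos_of_pos (by linarith)).le
end

section
/- Let α ∈ (1,2), β ∈ (1−1/α, 1), and η := 1 − α(1−β) ∈ (0,1). For v > 0 and z ≥ 0 set g(v,z) := v(1 + v^{−1/α} z)^{1−η} − v. Then for all real numbers v₁, v₂ with 0 < v₁ ≤ v₂ and all z ≥ 0, one has |g(v₂,z) − g(v₁,z)| ≤ 2·(v₂ − v₁)^{1−1/α}·z. -/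
theorem one_add_mul_rpow_sub_one_ge {p t x : ℝ} (hp₀ : 0 ≤ p) (hp₁ : p ≤ 1) (ht₀ : 0 ≤ t)
    (ht₁ : t ≤ 1) (hx : 0 ≤ x) : t * ((1 + x) ^ p - 1) ≤ (1 + t * x) ^ p - 1 := by
  have h := (Real.concaveOn_rpow hp₀ hp₁).2 (x := 1) (y := 1 + x) (by simp)
    (by simp only [Set.mem_Ici]; positivity) (sub_nonneg.2 ht₁) ht₀ (by ring)
  simp only [smul_eq_mul, Real.one_rpow, mul_one] at h
  have e : 1 - t + t * (1 + x) = 1 + t * x := by ring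
  rw [e] at h
  linarith

/-- The jump coefficient divided by `v`, shifted by one, is nonincreasing in `v`. -/
theorem one_add_rpow_neg_mul_rpow_antitone {q p z u v : ℝ} (hq : 0 ≤ q) (hp : 0 ≤ p) (hz : 0 ≤ z)
    (hu : 0 < u) (huv : u ≤ v) :
    (1 + v ^ (-q) * z) ^ p ≤ (1 + u ^ (-q) * z) ^ p := by
  have hv : 0 < v := hu.trans_le huv
  have h : v ^ (-q) ≤ u ^ (-q) := Real.rpow_le_rpow_of_nonpos hu huv (neg_nonpos.2 hq)
  gcongr

theorem mul_one_add_rpow_neg_mul_rpow_sub_one_mono {q p z u v : ℝ} (hq₁ : q ≤ 1)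
    (hp₀ : 0 ≤ p) (hp₁ : p ≤ 1) (hz : 0 ≤ z) (hu : 0 < u) (huv : u ≤ v) :
    u * ((1 + u ^ (-q) * z) ^ p - 1) ≤ v * ((1 + v ^ (-q) * z) ^ p - 1) := by
  have hv : 0 < v := hu.trans_le huv
  have hx : u / v * u ^ (-q) ≤ v ^ (-q) := by
    have h : u ^ (1 - q) ≤ v ^ (1 - q) := Real.rpow_le_rpow hu.le huv (sub_nonneg.2 hq₁)
    rw [sub_eq_add_neg, Real.rpow_add hu, Real.rpow_add hv, Real.rpow_one, Real.rpow_one] at h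
    rw [div_mul_eq_mul_div, div_le_iff₀ hv]
    linarith
  have hc := one_add_mul_rpow_sub_one_ge (x := u ^ (-q) * z) hp₀ hp₁ (div_nonneg hu.le hv.le)
    ((div_le_one hv).2 huv) (by positivity)
  have hm : (1 + u / v * (u ^ (-q) * z)) ^ p ≤ (1 + v ^ (-q) * z) ^ p := by
    rw [← mul_assoc]
    gcongr
  calc u * ((1 + u ^ (-q) * z) ^ p - 1) = v * (u / v * ((1 + u ^ (-q) * z) ^ p - 1)) := by
        field_simp
    _ ≤ v * ((1 + v ^ (-q) * z) ^ p - 1) := by gcongr; linarith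

theorem mul_one_add_rpow_neg_mul_rpow_sub_one_le {q p z v : ℝ} (hp₁ : p ≤ 1)
    (hz : 0 ≤ z) (hv : 0 < v) :
    v * ((1 + v ^ (-q) * z) ^ p - 1) ≤ v ^ (1 - q) * z := by
  have hx : 0 ≤ v ^ (-q) * z := by positivity
  have h : (1 + v ^ (-q) * z) ^ p ≤ 1 + v ^ (-q) * z := by
    simpa using Real.rpow_le_rpow_of_exponent_le (by linarith : 1 ≤ 1 + v ^ (-q) * z) hp₁
  rw [sub_eq_add_neg 1 q, Real.rpow_add hv, Real.rpow_one, mul_assoc]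
  gcongr
  linarith

theorem stmt_15 (α β η : ℝ) (hα₁ : 1 < α) (hα₂ : α < 2) (hβ₁ : 1 - 1 / α < β) (hβ₂ : β < 1)
    (hη : η = 1 - α * (1 - β)) (v₁ v₂ z : ℝ) (hv₁ : 0 < v₁) (hv : v₁ ≤ v₂) (hz : 0 ≤ z) :
    |(v₂ * (1 + v₂ ^ (-1 / α) * z) ^ (1 - η) - v₂) -
        (v₁ * (1 + v₁ ^ (-1 / α) * z) ^ (1 - η) - v₁)|
      ≤ 2 * (v₂ - v₁) ^ (1 - 1 / α) * z := by
  have hα : 0 < α := by linarith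
  have hq₀ : 0 ≤ 1 / α := by positivity
  have hq₁ : 1 / α ≤ 1 := (div_le_one hα).2 hα₁.le
  have hp₀ : 0 ≤ 1 - η := by
    rw [hη, sub_sub_cancel]
    exact mul_nonneg hα.le (by linarith)
  have hp₁ : 1 - η ≤ 1 := by
    have h : α * (1 - β) ≤ α * (1 / α) := by gcongr; linarith
    rw [mul_one_div_cancel hα.ne'] at h
    linarith
  rw [neg_div]
  generalize 1 / α = q at *
  generalize 1 - η = p at *
  rcases hv.eq_or_lt with rfl | hlt
  · simp only [sub_self, abs_zero]
    positivity
  have hd : 0 < v₂ - v₁ := sub_pos.2 hlt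
  have hmono := mul_one_add_rpow_neg_mul_rpow_sub_one_mono hq₁ hp₀ hp₁ hz hv₁ hv
  have hle := mul_one_add_rpow_neg_mul_rpow_sub_one_le (q := q) hp₁ hz hd
  have h₁ := mul_le_mul_of_nonneg_left
    (one_add_rpow_neg_mul_rpow_antitone hq₀ hp₀ hz hv₁ hv) hv₁.le
  have h₂ := mul_le_mul_of_nonneg_left
    (one_add_rpow_neg_mul_rpow_antitone hq₀ hp₀ hz hd (sub_le_self v₂ hv₁.le)) hd.le
  have hnn : 0 ≤ (v₂ - v₁) ^ (1 - q) * z := by positivity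
  rw [abs_of_nonneg (by linarith)]
  linarith
end
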